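/- There exists a function C₃ of one real variable such that: for every F ∈ C²(T⁵) satisfying the normalization (N) ∫_{[0,1]⁵}(e^F − 1) dx = 0, and every φ ∈ C⁴(T⁵) with ∫_{[−1/2,1/2]⁵} φ = 0 solving equation (★), one has ‖Δφ‖_{C⁰} ≤ C₃(‖F‖_{C²}), where Δφ = φ_{11}+φ_{22}+φ_{33}+φ_{44}+φ_{55}. -/

import Mathlib

open MeasureTheory

/-- Partial derivative in the `i`-th coordinate direction. -/
noncomputable def pd {n : ℕ} (i : Fin n) (f : (Fin n → ℝ) → ℝ) : (Fin n → ℝ) → ℝ :=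
  fun x => fderiv ℝ f x (Pi.single i 1)

/-- Second partial derivative `∂²f/∂x^i∂x^j`. -/
noncomputable def pd2 {n : ℕ} (i j : Fin n) (f : (Fin n → ℝ) → ℝ) : (Fin n → ℝ) → ℝ :=
  pd i (pd j f)

/-- A function on `ℝⁿ` that is `1`-periodic in every coordinate, i.e. a function on `Tⁿ`. -/
def PeriodicPi {n : ℕ} (f : (Fin n → ℝ) → ℝ) : Prop :=
  ∀ x : Fin n → ℝ, ∀ i : Fin n, f (x + Pi.single i 1) = f x

/-- The Euclidean Laplacian. -/
noncomputable def lap {n : ℕ} (f : (Fin n → ℝ) → ℝ) : (Fin n → ℝ) → ℝ :=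
  fun x => ∑ i, pd2 i i f x

/-- Equation (★): the reduction of the quaternionic Monge–Ampère equation to `T⁵`. -/
def EqStar (F φ : (Fin 5 → ℝ) → ℝ) : Prop :=
  ∀ x : Fin 5 → ℝ,
    (pd2 0 0 φ x + pd2 1 1 φ x + pd2 2 2 φ x + pd2 3 3 φ x + 1) * (pd2 4 4 φ x + 1)
      - (pd2 0 4 φ x) ^ 2 - (pd2 1 4 φ x) ^ 2 - (pd2 2 4 φ x) ^ 2 - (pd2 3 4 φ x) ^ 2
      = Real.exp (F x)

/-- Iterated partial derivative `∂^I f` for a multi-index `I`. -/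
noncomputable def pdI {n : ℕ} (I : Fin n → ℕ) (f : (Fin n → ℝ) → ℝ) : (Fin n → ℝ) → ℝ :=
  (List.finRange n).foldr (fun i g => (pd i)^[I i] g) f

/-- The `Cᵏ`-norm `max_{|I| ≤ k} sup_x |∂^I f(x)|`. -/
noncomputable def CNorm {n : ℕ} (k : ℕ) (f : (Fin n → ℝ) → ℝ) : ℝ :=
  ⨆ I : Fin n → ℕ, ⨆ _ : (∑ i, I i) ≤ k, ⨆ x : Fin n → ℝ, |pdI I f x|

/-- Second-order necessary condition at a local maximum. -/
lemma IsLocalMax.second_deriv_nonpos {g g' : ℝ → ℝ} {c x₀ : ℝ} (h : IsLocalMax g x₀)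
    (hg : ∀ x, HasDerivAt g (g' x) x) (hg' : HasDerivAt g' c x₀) : c ≤ 0 := by
  by_contra! hc
  have hd : deriv g = g' := funext fun x => (hg x).deriv
  have hmin : IsLocalMin g x₀ :=
    isLocalMin_of_deriv_deriv_pos (by rwa [hd, hg'.deriv]) h.deriv_eq_zero (hg x₀).continuousAt
  have hconst : g =ᶠ[nhds x₀] fun _ => g x₀ := by
    filter_upwards [h, hmin] with x h1 h2 using le_antisymm h1 h2
  have h2 : deriv (deriv g) x₀ = 0 := by
    simpa using (hconst.deriv.deriv_eq : deriv (deriv g) x₀ = _)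
  rw [hd, hg'.deriv] at h2
  exact hc.ne' h2

section PartialDerivatives

variable {n : ℕ}

lemma ContDiff.pd {m : ℕ} {f : (Fin n → ℝ) → ℝ} (hf : ContDiff ℝ (m + 1 : ℕ) f) (i : Fin n) :
    ContDiff ℝ m (pd i f) :=
  (hf.fderiv_right (m := m) (by norm_cast)).clm_apply contDiff_const

lemma ContDiff.pd2 {m : ℕ} {f : (Fin n → ℝ) → ℝ} (hf : ContDiff ℝ (m + 2 : ℕ) f)
    (i j : Fin n) : ContDiff ℝ m (pd2 i j f) :=
  ContDiff.pd (m := m) (ContDiff.pd (m := m + 1) hf j) i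

lemma PeriodicPi.pd {f : (Fin n → ℝ) → ℝ} (hf : PeriodicPi f) (i : Fin n) :
    PeriodicPi (pd i f) := by
  intro x j
  have : (fun y => f (y + Pi.single j 1)) = f := funext fun y => hf y j
  simp only [_root_.pd]
  rw [← fderiv_comp_add_right, this]

lemma PeriodicPi.pd2 {f : (Fin n → ℝ) → ℝ} (hf : PeriodicPi f) (i j : Fin n) :
    PeriodicPi (pd2 i j f) :=
  (hf.pd j).pd i

lemma fderiv_eq_sum_pd (f : (Fin n → ℝ) → ℝ) (x w : Fin n → ℝ) :
    fderiv ℝ f x w = ∑ i, w i * pd i f x := by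
  conv_lhs => rw [pi_eq_sum_univ' w]
  simp [pd, map_sum]

lemma hasDerivAt_line {f : (Fin n → ℝ) → ℝ} (hf : ContDiff ℝ 1 f) (p w : Fin n → ℝ) (t : ℝ) :
    HasDerivAt (fun t : ℝ => f (p + t • w)) (∑ i, w i * pd i f (p + t • w)) t := by
  rw [← fderiv_eq_sum_pd]
  have h1 : HasDerivAt (fun t : ℝ => p + t • w) w t := by
    simpa using ((hasDerivAt_id t).smul_const w).const_add p
  exact ((hf.differentiable one_ne_zero _).hasFDerivAt).comp_hasDerivAt t h1

lemma hasDerivAt_line_pd {f : (Fin n → ℝ) → ℝ} (hf : ContDiff ℝ 2 f) (p w : Fin n → ℝ) (t : ℝ) :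
    HasDerivAt (fun t : ℝ => ∑ i, w i * pd i f (p + t • w))
      (∑ i, w i * ∑ j, w j * pd2 j i f (p + t • w)) t :=
  HasDerivAt.fun_sum fun i _ =>
    (hasDerivAt_line (ContDiff.pd (m := 1) hf i) p w t).const_mul (w i)

/-- At a maximum, all second directional derivatives are nonpositive. -/
lemma sum_pd2_nonpos_of_max {f : (Fin n → ℝ) → ℝ} (hf : ContDiff ℝ 2 f) {p : Fin n → ℝ}
    (hp : ∀ x, f x ≤ f p) (w : Fin n → ℝ) : ∑ i, w i * ∑ j, w j * pd2 j i f p ≤ 0 := by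
  have hmax : IsLocalMax (fun t : ℝ => f (p + t • w)) 0 :=
    Filter.Eventually.of_forall fun t => by simpa using hp _
  simpa using hmax.second_deriv_nonpos (hasDerivAt_line (hf.of_le (by norm_num)) p w)
    (hasDerivAt_line_pd hf p w 0)

lemma pd2_self_nonpos_of_max {f : (Fin n → ℝ) → ℝ} (hf : ContDiff ℝ 2 f) {p : Fin n → ℝ}
    (hp : ∀ x, f x ≤ f p) (i : Fin n) : pd2 i i f p ≤ 0 := by
  simpa [Pi.single_apply] using sum_pd2_nonpos_of_max hf hp (Pi.single i 1)

lemma hasDerivAt_coord {f : (Fin n → ℝ) → ℝ} (hf : ContDiff ℝ 1 f) (p : Fin n → ℝ) (i : Fin n)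
    (t : ℝ) : HasDerivAt (fun t : ℝ => f (p + t • Pi.single i 1))
      (pd i f (p + t • Pi.single i 1)) t := by
  simpa [Pi.single_apply] using hasDerivAt_line hf p (Pi.single i 1) t

lemma pd_comm {f : (Fin n → ℝ) → ℝ} (hf : ContDiff ℝ 2 f) (i j : Fin n) :
    pd i (pd j f) = pd j (pd i f) := by
  have hd : Differentiable ℝ (fderiv ℝ f) :=
    (hf.fderiv_right (m := 1) (by norm_num)).differentiable one_ne_zero
  have key : ∀ (i j : Fin n) (x : Fin n → ℝ),
      pd i (pd j f) x = fderiv ℝ (fderiv ℝ f) x (Pi.single i 1) (Pi.single j 1) := by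
    intro i j x
    unfold pd
    rw [fderiv_clm_apply (hd x) (differentiableAt_const _)]
    simp
  funext x
  rw [key, key]
  exact (hf.contDiffAt.isSymmSndFDerivAt (by simp)).eq _ _

lemma pd2_comm {f : (Fin n → ℝ) → ℝ} (hf : ContDiff ℝ 4 f) (i j k l : Fin n) :
    pd2 i j (pd2 k l f) = pd2 k l (pd2 i j f) := by
  have h1 : ∀ a, ContDiff ℝ 3 (pd a f) := fun a => ContDiff.pd (m := 3) hf a
  have h2 : ∀ a b, ContDiff ℝ 2 (pd a (pd b f)) := fun a b => ContDiff.pd (m := 2) (h1 b) a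
  have h32 : ∀ a, ContDiff ℝ 2 (pd a f) := fun a => (h1 a).of_le (by norm_num)
  have h42 : ContDiff ℝ 2 f := hf.of_le (by norm_num)
  unfold pd2
  rw [pd_comm (h32 l) j k, pd_comm h42 j l, pd_comm (h2 l j) i k, pd_comm (h32 j) i l]

lemma pd_add {f g : (Fin n → ℝ) → ℝ} (hf : ContDiff ℝ 1 f) (hg : ContDiff ℝ 1 g) (i : Fin n) :
    pd i (fun x => f x + g x) = fun x => pd i f x + pd i g x := by
  funext x
  simp [pd, fderiv_fun_add (hf.differentiable one_ne_zero x) (hg.differentiable one_ne_zero x)]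

lemma pd_const_mul {f : (Fin n → ℝ) → ℝ} (hf : ContDiff ℝ 1 f) (c : ℝ) (i : Fin n) :
    pd i (fun x => c * f x) = fun x => c * pd i f x := by
  funext x
  simp [pd, fderiv_const_mul (hf.differentiable one_ne_zero x)]

lemma pd2_add {f g : (Fin n → ℝ) → ℝ} (hf : ContDiff ℝ 2 f) (hg : ContDiff ℝ 2 g)
    (i j : Fin n) : pd2 i j (fun x => f x + g x) = fun x => pd2 i j f x + pd2 i j g x := by
  unfold pd2
  rw [pd_add (hf.of_le (by norm_num)) (hg.of_le (by norm_num)),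
    pd_add (ContDiff.pd (m := 1) hf j) (ContDiff.pd (m := 1) hg j)]

lemma pd2_const_mul {f : (Fin n → ℝ) → ℝ} (hf : ContDiff ℝ 2 f) (c : ℝ) (i j : Fin n) :
    pd2 i j (fun x => c * f x) = fun x => c * pd2 i j f x := by
  unfold pd2
  rw [pd_const_mul (hf.of_le (by norm_num)), pd_const_mul (ContDiff.pd (m := 1) hf j)]

lemma pd2_sub {f g : (Fin n → ℝ) → ℝ} (hf : ContDiff ℝ 2 f) (hg : ContDiff ℝ 2 g)
    (i j : Fin n) : pd2 i j (fun x => f x - g x) = fun x => pd2 i j f x - pd2 i j g x := by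
  have : (fun x => f x - g x) = fun x => f x + (-1) * g x := by funext x; ring
  rw [this, pd2_add hf (contDiff_const.mul hg), pd2_const_mul hg]
  funext x; ring

lemma pd_comp_clm {f : (Fin n → ℝ) → ℝ} (hf : ContDiff ℝ 1 f)
    (P : (Fin n → ℝ) →L[ℝ] (Fin n → ℝ)) (i : Fin n) (x : Fin n → ℝ) :
    pd i (fun y => f (P y)) x = fderiv ℝ f (P x) (P (Pi.single i 1)) := by
  have := ((hf.differentiable one_ne_zero (P x)).hasFDerivAt.comp x P.hasFDerivAt).fderiv
  simp only [pd]
  exact congrArg (fun L => L (Pi.single i 1)) this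

lemma PeriodicPi.add_sum_intCast {f : (Fin n → ℝ) → ℝ} (hf : PeriodicPi f) (x : Fin n → ℝ)
    (m : Fin n → ℤ) : f (x + fun i => (m i : ℝ)) = f x := by
  have hs : ∀ s : Finset (Fin n), f (x + ∑ i ∈ s, m i • (Pi.single i 1 : Fin n → ℝ)) = f x := by
    intro s
    induction s using Finset.induction_on with
    | empty => simp
    | insert a s ha ih =>
      rw [Finset.sum_insert ha, add_comm (m a • _), ← add_assoc]
      exact ((show Function.Periodic f (Pi.single a 1) from fun y => hf y a).zsmul (m a) _).trans ih
  convert hs Finset.univ using 3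
  funext i
  simp [Finset.sum_apply, Pi.single_apply]

lemma PeriodicPi.exists_eq_mem_Icc {f : (Fin n → ℝ) → ℝ} (hf : PeriodicPi f) (x : Fin n → ℝ) :
    f (fun i => Int.fract (x i)) = f x := by
  rw [← hf.add_sum_intCast _ (fun i => ⌊x i⌋)]
  congr 1
  funext i
  simp

lemma fract_mem_Icc (x : Fin n → ℝ) : (fun i => Int.fract (x i)) ∈ Set.Icc (0 : Fin n → ℝ) 1 :=
  ⟨fun _ => Int.fract_nonneg _, fun _ => (Int.fract_lt_one _).le⟩

lemma PeriodicPi.exists_max {f : (Fin n → ℝ) → ℝ} (hf : PeriodicPi f) (hc : Continuous f) :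
    ∃ p, ∀ x, f x ≤ f p := by
  obtain ⟨p, -, hp⟩ := isCompact_Icc.exists_isMaxOn
    (⟨0, by simp⟩ : (Set.Icc (0 : Fin n → ℝ) 1).Nonempty) hc.continuousOn
  refine ⟨p, fun x => ?_⟩
  rw [← hf.exists_eq_mem_Icc x]
  exact hp (fract_mem_Icc x)

lemma bddAbove_pdI (k : ℕ) (f : (Fin n → ℝ) → ℝ) :
    BddAbove (Set.range fun I : Fin n → ℕ => ⨆ _ : (∑ i, I i) ≤ k, ⨆ x, |pdI I f x|) := by
  have hfin : {I : Fin n → ℕ | ∑ i, I i ≤ k}.Finite :=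
    (Set.finite_Icc (0 : Fin n → ℕ) (fun _ => k)).subset fun I hI =>
      ⟨fun i => Nat.zero_le _,
        fun i => (Finset.single_le_sum (fun j _ => Nat.zero_le (I j)) (Finset.mem_univ i)).trans hI⟩
  refine (((hfin.image fun I => ⨆ x, |pdI I f x|).insert 0).subset ?_).bddAbove
  rintro _ ⟨I, rfl⟩
  by_cases hI : ∑ i, I i ≤ k
  · exact Or.inr ⟨I, hI, by simp [hI]⟩
  · exact Or.inl (by simp [hI])

lemma abs_pdI_le_CNorm {k : ℕ} {f : (Fin n → ℝ) → ℝ} (I : Fin n → ℕ) (hI : ∑ i, I i ≤ k)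
    (hper : PeriodicPi (pdI I f)) (hcont : Continuous (pdI I f)) (x : Fin n → ℝ) :
    |pdI I f x| ≤ CNorm k f := by
  obtain ⟨p, hp⟩ := PeriodicPi.exists_max (f := fun x => |pdI I f x|)
    (fun x i => by simp only [hper x i]) hcont.abs
  have h1 : |pdI I f x| ≤ ⨆ x, |pdI I f x| :=
    le_ciSup (f := fun x => |pdI I f x|) ⟨_, by rintro _ ⟨y, rfl⟩; exact hp y⟩ x
  have h2 := le_ciSup (bddAbove_pdI k f) I
  simp only [hI, ciSup_unique] at h2
  exact h1.trans h2

lemma pdI_zero (f : (Fin n → ℝ) → ℝ) : pdI 0 f = f := by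
  simp [pdI]

lemma CNorm_zero_le {f : (Fin n → ℝ) → ℝ} {C : ℝ} (hC : 0 ≤ C) (h : ∀ x, |f x| ≤ C) :
    CNorm 0 f ≤ C := by
  refine Real.iSup_le (fun I => Real.iSup_le (fun hI => Real.iSup_le (fun x => ?_) hC) hC) hC
  have : I = 0 := by
    funext i
    exact (Finset.sum_eq_zero_iff.mp (Nat.le_zero.mp hI)) i (Finset.mem_univ i)
  rw [this, pdI_zero]
  exact h x

lemma pdI_single_two (f : (Fin n → ℝ) → ℝ) (k : Fin n) : pdI (Pi.single k 2) f = pd2 k k f := by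
  have key : ∀ l : List (Fin n), l.Nodup →
      l.foldr (fun i g => (pd i)^[(Pi.single k 2 : Fin n → ℕ) i] g) f =
        if k ∈ l then pd2 k k f else f := by
    intro l
    induction l with
    | nil => simp
    | cons a l ih =>
      intro hl
      rw [List.nodup_cons] at hl
      rw [List.foldr_cons, ih hl.2]
      by_cases hak : a = k
      · subst hak
        simp [hl.1, pd2]
      · simp [hak, Ne.symm hak]
  simpa [pdI] using key _ (List.nodup_finRange n)

lemma abs_le_CNorm {k : ℕ} {f : (Fin n → ℝ) → ℝ} (hf : Continuous f) (hper : PeriodicPi f)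
    (x : Fin n → ℝ) : |f x| ≤ CNorm k f := by
  simpa only [pdI_zero] using abs_pdI_le_CNorm (k := k) (f := f) 0 (by simp)
    (by rwa [pdI_zero]) (by rwa [pdI_zero]) x

lemma abs_pd2_self_le_CNorm {f : (Fin n → ℝ) → ℝ} (hf : ContDiff ℝ 2 f) (hper : PeriodicPi f)
    (i : Fin n) (x : Fin n → ℝ) : |pd2 i i f x| ≤ CNorm 2 f := by
  simpa only [pdI_single_two] using abs_pdI_le_CNorm (k := 2) (f := f) (Pi.single i 2) (by simp)
    (by rw [pdI_single_two]; exact hper.pd2 i i)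
    (by rw [pdI_single_two]; exact (ContDiff.pd2 (m := 0) hf i i).continuous) x

end PartialDerivatives

section Oscillation

variable {n : ℕ}

lemma PeriodicPi.fract_smul_single {f : (Fin n → ℝ) → ℝ} (hf : PeriodicPi f) (p : Fin n → ℝ)
    (i : Fin n) (t : ℝ) :
    f (p + Int.fract t • Pi.single i 1) = f (p + t • Pi.single i 1) := by
  have h := (show Function.Periodic f (Pi.single i 1) from fun y => hf y i).zsmul ⌊t⌋
    (p + Int.fract t • Pi.single i 1)
  rw [← h, add_assoc, ← Int.cast_smul_eq_zsmul ℝ, ← add_smul, Int.fract_add_floor]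

/-- A periodic function which becomes convex in the `i`-th variable after adding `xᵢ²/2` has
bounded oscillation in that variable. -/
lemma osc_le_of_neg_one_lt_pd2 {f : (Fin n → ℝ) → ℝ} (hf : ContDiff ℝ 2 f)
    (hper : PeriodicPi f) (i : Fin n) (hi : ∀ x, -1 < pd2 i i f x) (p : Fin n → ℝ) (t : ℝ) :
    f (p + t • Pi.single i 1) - f p ≤ 1 / 8 := by
  rw [← hper.fract_smul_single]
  set τ := Int.fract t
  have hτ : τ ∈ Set.Icc (0 : ℝ) 1 := ⟨Int.fract_nonneg _, (Int.fract_lt_one _).le⟩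
  set g : ℝ → ℝ := fun s => f (p + s • Pi.single i 1) - (s - s ^ 2) / 2 with hg
  have hderiv : ∀ s, HasDerivAt g (pd i f (p + s • Pi.single i 1) - (1 - 2 * s) / 2) s := by
    intro s
    have h2 := ((hasDerivAt_id s).sub ((hasDerivAt_id s).pow 2)).div_const 2
    refine ((hasDerivAt_coord (hf.of_le (by norm_num)) p i s).sub h2).congr_deriv ?_
    simp
  have hderiv2 : ∀ s, HasDerivAt (fun s => pd i f (p + s • Pi.single i 1) - (1 - 2 * s) / 2)
      (pd2 i i f (p + s • Pi.single i 1) + 1) s := by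
    intro s
    have h2 := ((((hasDerivAt_id s).const_mul 2).const_sub 1)).div_const 2
    refine ((hasDerivAt_coord (ContDiff.pd (m := 1) hf i) p i s).sub h2).congr_deriv ?_
    simp [pd2]
  obtain ⟨s, hs, hmax⟩ := isCompact_Icc.exists_isMaxOn (Set.nonempty_Icc.2 zero_le_one)
    (continuous_iff_continuousAt.2 fun s => (hderiv s).continuousAt).continuousOn
  have hgs : g s = f p := by
    rcases eq_or_lt_of_le hs.1 with h0 | h0
    · simp [hg, ← h0]
    rcases eq_or_lt_of_le hs.2 with h1 | h1
    · simp [hg, h1, hper p i]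
    have := (hmax.isLocalMax (Icc_mem_nhds h0 h1)).second_deriv_nonpos hderiv (hderiv2 s)
    linarith [hi (p + s • Pi.single i 1)]
  have hle : g τ ≤ g s := hmax hτ
  rw [hgs] at hle
  simp only [hg] at hle
  nlinarith [sq_nonneg (τ - 1 / 2)]

/-- A periodic function whose Laplacian in the variables of `S` is bounded has bounded oscillation
in each of these variables: compare `f (x + s eᵢ) - f (x - s eᵢ)` with a parabola in `s`. -/
lemma osc_le_of_sum_pd2_bounds {f : (Fin n → ℝ) → ℝ} (hf : ContDiff ℝ 2 f)
    (hper : PeriodicPi f) (S : Finset (Fin n)) {a b : ℝ} (ha : ∀ x, a < ∑ j ∈ S, pd2 j j f x)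
    (hb : ∀ x, ∑ j ∈ S, pd2 j j f x ≤ b) {i : Fin n} (hi : i ∈ S) (p : Fin n → ℝ) (t : ℝ) :
    f (p + t • Pi.single i 1) - f p ≤ (b - a) / 32 := by
  set e : Fin n → ℝ := Pi.single i 1 with he
  set K : ℝ := (b - a) / 2 with hK
  have hK0 : 0 < K := by have := (ha 0).trans_le (hb 0); simp only [hK]; linarith
  set G : (Fin n → ℝ) × ℝ → ℝ :=
    fun z => f (z.1 + z.2 • e) - f (z.1 + (-z.2) • e) - K * (z.2 / 2 - z.2 ^ 2) with hG
  have hGcont : Continuous G := by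
    have := hf.continuous
    fun_prop
  obtain ⟨⟨q, s⟩, hqs, hmax⟩ := (isCompact_Icc.prod isCompact_Icc).exists_isMaxOn
    (s := Set.Icc (0 : Fin n → ℝ) 1 ×ˢ Set.Icc (0 : ℝ) (1 / 2)) ⟨(0, 0), by simp⟩
    hGcont.continuousOn
  have hs : s ∈ Set.Icc (0 : ℝ) (1 / 2) := hqs.2
  have hGper : ∀ r, PeriodicPi fun x => G (x, r) := by
    intro r x j
    simp only [hG, add_right_comm x (Pi.single j 1), hper _ j]
  have hGle : ∀ x, ∀ r ∈ Set.Icc (0 : ℝ) (1 / 2), G (x, r) ≤ G (q, s) := by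
    intro x r hr
    rw [← (hGper r).exists_eq_mem_Icc x]
    exact hmax ⟨fract_mem_Icc x, hr⟩
  have hGqs : G (q, s) = 0 := by
    rcases eq_or_lt_of_le hs.1 with h0 | h0
    · simp [hG, ← h0]
    rcases eq_or_lt_of_le hs.2 with h1 | h1
    · have h2 : f (q + (1 / 2 : ℝ) • e) = f (q + (-(1 / 2) : ℝ) • e) := by
        rw [← hper (q + (-(1 / 2) : ℝ) • e) i, add_assoc]
        congr 2
        rw [← he]
        module
      simp only [hG, h1, h2]
      norm_num
    exfalso
    have hderiv : ∀ r, HasDerivAt (fun r => G (q, r))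
        (pd i f (q + r • e) + pd i f (q + (-r) • e) - K * (1 / 2 - 2 * r)) r := by
      intro r
      have h1 := hasDerivAt_coord (hf.of_le (by norm_num)) q i r
      have h2 := (hasDerivAt_coord (hf.of_le (by norm_num)) q i (-r)).comp r (hasDerivAt_neg r)
      have h3 := ((((hasDerivAt_id r).div_const 2).sub ((hasDerivAt_id r).pow 2))).const_mul K
      refine ((h1.sub h2).sub h3).congr_deriv ?_
      simp [he]
    have hderiv2 : ∀ r, HasDerivAt
        (fun r => pd i f (q + r • e) + pd i f (q + (-r) • e) - K * (1 / 2 - 2 * r))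
        (pd2 i i f (q + r • e) - pd2 i i f (q + (-r) • e) + 2 * K) r := by
      intro r
      have hc := ContDiff.pd (m := 1) hf i
      have h1 := hasDerivAt_coord hc q i r
      have h2 := (hasDerivAt_coord hc q i (-r)).comp r (hasDerivAt_neg r)
      have h3 := (((hasDerivAt_id r).const_mul 2).const_sub (1 / 2)).const_mul K
      refine ((h1.add h2).sub h3).congr_deriv ?_
      simp [pd2, he]
      ring
    have hloc : IsLocalMax (fun r => G (q, r)) s := by
      filter_upwards [Icc_mem_nhds h0 h1] with r hr using hGle q r hr
    have hii := hloc.second_deriv_nonpos hderiv (hderiv2 s)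
    have hshift : ∀ c : Fin n → ℝ, ContDiff ℝ 2 fun x => f (x + c) := fun c =>
      hf.comp (contDiff_id.add contDiff_const)
    have hpd2shift : ∀ (c : Fin n → ℝ) (j : Fin n),
        pd2 j j (fun x => f (x + c)) = fun x => pd2 j j f (x + c) := by
      have hpd : ∀ (g : (Fin n → ℝ) → ℝ) (c : Fin n → ℝ) (j : Fin n),
          pd j (fun x => g (x + c)) = fun x => pd j g (x + c) := fun g c j => by
        funext x
        simp only [pd, fderiv_comp_add_right]
      intro c j
      rw [pd2, hpd, hpd, ← pd2]
    have hjj : ∀ j, pd2 j j f (q + s • e) - pd2 j j f (q + (-s) • e) ≤ 0 := by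
      intro j
      have := pd2_self_nonpos_of_max ((hshift (s • e)).sub (hshift ((-s) • e))) (p := q)
        (fun x => by have := hGle x s hs; simp only [hG] at this; linarith) j
      rwa [pd2_sub (hshift _) (hshift _), hpd2shift, hpd2shift] at this
    have hsum := Finset.sum_le_sum fun j (_ : j ∈ S.erase i) => hjj j
    rw [Finset.sum_sub_distrib, Finset.sum_const_zero] at hsum
    have h3 := ha (q + s • e)
    have h4 := hb (q + (-s) • e)
    rw [← Finset.add_sum_erase _ _ hi] at h3 h4
    simp only [hK] at hii
    linarith
  rw [← hper.fract_smul_single]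
  set τ := Int.fract t
  have hτ0 : 0 ≤ τ := Int.fract_nonneg _
  have hτ1 : τ < 1 := Int.fract_lt_one _
  have hle := hGle (p + (τ / 2) • e) (τ / 2) ⟨by linarith, by linarith⟩
  have h1 : p + (τ / 2) • e + (τ / 2) • e = p + τ • e := by module
  have h2 : p + (τ / 2) • e + (-(τ / 2)) • e = p := by module
  rw [hGqs] at hle
  simp only [hG, h1, h2] at hle
  have h3 : K * (τ / 2 / 2 - (τ / 2) ^ 2) ≤ K * (1 / 16) :=
    mul_le_mul_of_nonneg_left (by nlinarith [sq_nonneg (τ - 1 / 2)]) hK0.le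
  simp only [hK] at h3 hle
  linarith

end Oscillation

section EqStar

/-- The linearisation at `φ` of the operator in `EqStar`, applied to `u`. -/
noncomputable def starLin (φ u : (Fin 5 → ℝ) → ℝ) (p : Fin 5 → ℝ) : ℝ :=
  (pd2 4 4 φ p + 1) * (pd2 0 0 u p + pd2 1 1 u p + pd2 2 2 u p + pd2 3 3 u p)
    + (pd2 0 0 φ p + pd2 1 1 φ p + pd2 2 2 φ p + pd2 3 3 φ p + 1) * pd2 4 4 u p
    - 2 * (pd2 0 4 φ p * pd2 0 4 u p + pd2 1 4 φ p * pd2 1 4 u p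
      + pd2 2 4 φ p * pd2 2 4 u p + pd2 3 4 φ p * pd2 3 4 u p)

variable {F φ u w : (Fin 5 → ℝ) → ℝ}

lemma starLin_add (hu : ContDiff ℝ 2 u) (hw : ContDiff ℝ 2 w) (p : Fin 5 → ℝ) :
    starLin φ (fun x => u x + w x) p = starLin φ u p + starLin φ w p := by
  simp only [starLin, pd2_add hu hw]
  ring

lemma starLin_sub (hu : ContDiff ℝ 2 u) (hw : ContDiff ℝ 2 w) (p : Fin 5 → ℝ) :
    starLin φ (fun x => u x - w x) p = starLin φ u p - starLin φ w p := by
  simp only [starLin, pd2_sub hu hw]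
  ring

lemma starLin_self (h : EqStar F φ) (p : Fin 5 → ℝ) :
    starLin φ φ p = 2 * Real.exp (F p)
      - (pd2 0 0 φ p + pd2 1 1 φ p + pd2 2 2 φ p + pd2 3 3 φ p + 1) - (pd2 4 4 φ p + 1) := by
  rw [← h p, starLin]
  ring

/-- For a solution of `EqStar`, both diagonal factors are positive. -/
lemma EqStar.factors_pos (h : EqStar F φ) (hφ : ContDiff ℝ 2 φ) (hper : PeriodicPi φ)
    (x : Fin 5 → ℝ) :
    0 < pd2 0 0 φ x + pd2 1 1 φ x + pd2 2 2 φ x + pd2 3 3 φ x + 1 ∧ 0 < pd2 4 4 φ x + 1 := by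
  have hmul : ∀ x, 0 < (pd2 0 0 φ x + pd2 1 1 φ x + pd2 2 2 φ x + pd2 3 3 φ x + 1) *
      (pd2 4 4 φ x + 1) := fun x => by
    have h1 := h x
    have h2 := Real.exp_pos (F x)
    nlinarith [sq_nonneg (pd2 0 4 φ x), sq_nonneg (pd2 1 4 φ x), sq_nonneg (pd2 2 4 φ x),
      sq_nonneg (pd2 3 4 φ x)]
  have hcont : Continuous fun x => pd2 4 4 φ x + 1 :=
    (ContDiff.pd2 (m := 0) hφ 4 4).continuous.add continuous_const
  have hB : ∀ x, 0 < pd2 4 4 φ x + 1 := by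
    obtain ⟨p, hp⟩ := PeriodicPi.exists_max (f := fun x => (-1) * φ x)
      (fun x i => by simp only [hper x i]) (continuous_const.mul hφ.continuous)
    have hpos : 0 < pd2 4 4 φ p + 1 := by
      have := pd2_self_nonpos_of_max (contDiff_const.mul hφ) hp 4
      rw [pd2_const_mul hφ] at this
      linarith
    intro x
    by_contra! hx
    obtain ⟨z, hz⟩ := intermediate_value_univ x p hcont ⟨hx, hpos.le⟩
    have := hmul z
    simp only at hz
    simp [hz] at this
  exact ⟨pos_of_mul_pos_left (hmul x) (hB x).le, hB x⟩

/-- Ellipticity: the linearised operator is nonpositive at a maximum. -/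
lemma EqStar.starLin_nonpos_of_max (h : EqStar F φ) (hφ : ContDiff ℝ 2 φ) (hper : PeriodicPi φ)
    (hu : ContDiff ℝ 2 u) {p : Fin 5 → ℝ} (hp : ∀ x, u x ≤ u p) : starLin φ u p ≤ 0 := by
  obtain ⟨-, hB⟩ := h.factors_pos hφ hper p
  have hdir : ∀ (i : Fin 5) (c : ℝ),
      pd2 i i u p + 2 * c * pd2 i 4 u p + c ^ 2 * pd2 4 4 u p ≤ 0 := by
    intro i c
    have h1 := sum_pd2_nonpos_of_max hu hp (Pi.single i 1 + c • Pi.single 4 1)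
    have h2 : pd2 4 i u = pd2 i 4 u := pd_comm hu 4 i
    simp [add_mul, Finset.sum_add_distrib, Pi.single_apply, h2] at h1
    linarith
  have h44 : pd2 4 4 u p ≤ 0 := pd2_self_nonpos_of_max hu hp 4
  have heq := h p
  have hE := Real.exp_pos (F p)
  set B := pd2 4 4 φ p + 1 with hBdef
  set A := pd2 0 0 φ p + pd2 1 1 φ p + pd2 2 2 φ p + pd2 3 3 φ p + 1 with hAdef
  have hdir' : ∀ i : Fin 5, B ^ 2 * pd2 i i u p - 2 * B * pd2 i 4 φ p * pd2 i 4 u p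
      + pd2 i 4 φ p ^ 2 * pd2 4 4 u p ≤ 0 := by
    intro i
    have h1 := mul_nonpos_of_nonneg_of_nonpos (sq_nonneg B) (hdir i (-(pd2 i 4 φ p / B)))
    have h2 : B ^ 2 * (pd2 i i u p + 2 * (-(pd2 i 4 φ p / B)) * pd2 i 4 u p
        + (-(pd2 i 4 φ p / B)) ^ 2 * pd2 4 4 u p) = B ^ 2 * pd2 i i u p
        - 2 * B * pd2 i 4 φ p * pd2 i 4 u p + pd2 i 4 φ p ^ 2 * pd2 4 4 u p := by
      field_simp
      ring
    linarith
  have hmul : B * starLin φ u p ≤ 0 := by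
    have h1 : B * starLin φ u p = (B ^ 2 * pd2 0 0 u p - 2 * B * pd2 0 4 φ p * pd2 0 4 u p
        + pd2 0 4 φ p ^ 2 * pd2 4 4 u p) + (B ^ 2 * pd2 1 1 u p
        - 2 * B * pd2 1 4 φ p * pd2 1 4 u p + pd2 1 4 φ p ^ 2 * pd2 4 4 u p)
        + (B ^ 2 * pd2 2 2 u p - 2 * B * pd2 2 4 φ p * pd2 2 4 u p
        + pd2 2 4 φ p ^ 2 * pd2 4 4 u p) + (B ^ 2 * pd2 3 3 u p
        - 2 * B * pd2 3 4 φ p * pd2 3 4 u p + pd2 3 4 φ p ^ 2 * pd2 4 4 u p)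
        + Real.exp (F p) * pd2 4 4 u p := by
      rw [← heq, starLin, ← hBdef, ← hAdef]
      ring
    have h2 := mul_nonpos_of_nonneg_of_nonpos hE.le h44
    linarith [hdir' 0, hdir' 1, hdir' 2, hdir' 3]
  exact nonpos_of_mul_nonpos_right hmul hB

/-- Reverse Cauchy–Schwarz inequality for the Lorentzian form `AB - |v|²`. -/
lemma lorentz_reverse_cauchy_schwarz {A B a b s t v₀ v₁ v₂ v₃ w₀ w₁ w₂ w₃ : ℝ} (hB : 0 < B)
    (hb : 0 < b) (h₁ : A * B - v₀ ^ 2 - v₁ ^ 2 - v₂ ^ 2 - v₃ ^ 2 = s ^ 2)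
    (h₂ : a * b - w₀ ^ 2 - w₁ ^ 2 - w₂ ^ 2 - w₃ ^ 2 = t ^ 2) :
    2 * (s * t) ≤ B * a + A * b - 2 * (v₀ * w₀ + v₁ * w₁ + v₂ * w₂ + v₃ * w₃) := by
  have key : (B * b) * (B * a + A * b - 2 * (v₀ * w₀ + v₁ * w₁ + v₂ * w₂ + v₃ * w₃) - 2 * (s * t))
      = (B * w₀ - b * v₀) ^ 2 + (B * w₁ - b * v₁) ^ 2 + (B * w₂ - b * v₂) ^ 2
        + (B * w₃ - b * v₃) ^ 2 + (B * t - b * s) ^ 2 := by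
    linear_combination B ^ 2 * h₂ + b ^ 2 * h₁
  have hnn : 0 ≤ (B * b) *
      (B * a + A * b - 2 * (v₀ * w₀ + v₁ * w₁ + v₂ * w₂ + v₃ * w₃) - 2 * (s * t)) := by
    rw [key]; positivity
  linarith [nonneg_of_mul_nonneg_right hnn (mul_pos hB hb)]

/-- Concavity of the equation bounds the linearised operator on second derivatives of `φ`. -/
lemma EqStar.le_starLin_pd2 (h : EqStar F φ) (hF : ContDiff ℝ 2 F) (hφ : ContDiff ℝ 4 φ)
    (hper : PeriodicPi φ) (k : Fin 5) (p : Fin 5 → ℝ) :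
    Real.exp (F p) * pd2 k k F p ≤ starLin φ (pd2 k k φ) p := by
  have hφ2 : ContDiff ℝ 2 φ := hφ.of_le (by norm_num)
  have hc : ∀ i j, ContDiff ℝ 2 (pd2 i j φ) := fun i j => ContDiff.pd2 (m := 2) hφ i j
  set G : (Fin 5 → ℝ) → ℝ := fun x => Real.exp (F p) * F x
    - ((pd2 4 4 φ p + 1) * (pd2 0 0 φ x + pd2 1 1 φ x + pd2 2 2 φ x + pd2 3 3 φ x)
    + (pd2 0 0 φ p + pd2 1 1 φ p + pd2 2 2 φ p + pd2 3 3 φ p + 1) * pd2 4 4 φ x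
    - 2 * (pd2 0 4 φ p * pd2 0 4 φ x + pd2 1 4 φ p * pd2 1 4 φ x
      + pd2 2 4 φ p * pd2 2 4 φ x + pd2 3 4 φ p * pd2 3 4 φ x)) with hG
  have hmax : ∀ x, G x ≤ G p := by
    intro x
    have hexp : ∀ y, Real.exp (F y) = Real.exp (F y / 2) ^ 2 := fun y => by
      rw [← Real.exp_nat_mul]; congr 1; push_cast; ring
    have hrcs := lorentz_reverse_cauchy_schwarz (h.factors_pos hφ2 hper p).2
      (h.factors_pos hφ2 hper x).2 ((h p).trans (hexp p)) ((h x).trans (hexp x))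
    have h1 : Real.exp (F p / 2) * Real.exp (F x / 2)
        = Real.exp (F p) * Real.exp ((F x - F p) / 2) := by
      rw [← Real.exp_add, ← Real.exp_add]; congr 1; ring
    have h2 := mul_le_mul_of_nonneg_left (Real.add_one_le_exp ((F x - F p) / 2))
      (Real.exp_pos (F p)).le
    rw [h1] at hrcs
    have h3 := h p
    simp only [hG]
    linarith
  have hpd2G : pd2 k k G p = Real.exp (F p) * pd2 k k F p - starLin φ (pd2 k k φ) p := by
    simp only [hG, starLin]
    simp (disch := fun_prop) only [pd2_sub, pd2_add, pd2_const_mul, pd2_comm hφ k k]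
  have hGc : ContDiff ℝ 2 G := by fun_prop
  linarith [pd2_self_nonpos_of_max hGc hmax k]

end EqStar

section Estimates

/-- The projection of `ℝ⁵` onto the hyperplane `x₄ = 0`. -/
noncomputable def dropLast : (Fin 5 → ℝ) →L[ℝ] (Fin 5 → ℝ) :=
  ContinuousLinearMap.pi fun i => if i = 4 then 0 else ContinuousLinearMap.proj i

lemma dropLast_apply (x : Fin 5 → ℝ) (i : Fin 5) :
    dropLast x i = if i = 4 then 0 else x i := by
  by_cases h : i = 4 <;> simp [dropLast, h]

lemma dropLast_single {i : Fin 5} (hi : i ≠ 4) :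
    dropLast (Pi.single i 1) = Pi.single i 1 := by
  ext j
  rw [dropLast_apply]
  split_ifs with h
  · rw [h, Pi.single_eq_of_ne hi.symm]
  · rfl

lemma dropLast_single_last : dropLast (Pi.single 4 1) = 0 := by
  ext j
  rw [dropLast_apply]
  split_ifs with h
  · rfl
  · simp [h]

lemma dropLast_eq_add (x : Fin 5 → ℝ) : dropLast x = x + (-x 4) • Pi.single 4 1 := by
  ext j
  rw [dropLast_apply]
  split_ifs with h
  · simp [h]
  · simp [h]

lemma pd_comp_dropLast {f : (Fin 5 → ℝ) → ℝ} (hf : ContDiff ℝ 1 f) {i : Fin 5} (hi : i ≠ 4) :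
    pd i (fun x => f (dropLast x)) = fun x => pd i f (dropLast x) := by
  funext x
  rw [pd_comp_clm hf, dropLast_single hi, pd]

lemma pd_last_comp_dropLast {f : (Fin 5 → ℝ) → ℝ} (hf : ContDiff ℝ 1 f) :
    pd 4 (fun x => f (dropLast x)) = fun _ => 0 := by
  funext x
  rw [pd_comp_clm hf, dropLast_single_last, map_zero]

lemma pd2_comp_dropLast {f : (Fin 5 → ℝ) → ℝ} (hf : ContDiff ℝ 2 f) {i : Fin 5} (hi : i ≠ 4) :
    pd2 i i (fun x => f (dropLast x)) = fun x => pd2 i i f (dropLast x) := by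
  rw [pd2, pd_comp_dropLast (hf.of_le (by norm_num)) hi,
    pd_comp_dropLast (ContDiff.pd (m := 1) hf i) hi, ← pd2]

lemma pd2_last_comp_dropLast {f : (Fin 5 → ℝ) → ℝ} (hf : ContDiff ℝ 2 f) (i : Fin 5) :
    pd2 i 4 (fun x => f (dropLast x)) = fun _ => 0 := by
  rw [pd2, pd_last_comp_dropLast (hf.of_le (by norm_num))]
  funext x
  simp [pd]

lemma PeriodicPi.comp_dropLast {f : (Fin 5 → ℝ) → ℝ} (hf : PeriodicPi f) :
    PeriodicPi fun x => f (dropLast x) := by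
  intro x i
  simp only [map_add]
  by_cases hi : i = 4
  · rw [hi, dropLast_single_last, add_zero]
  · rw [dropLast_single hi, hf]

variable {F φ : (Fin 5 → ℝ) → ℝ}

/-- The oscillation of a solution in the last variable is at most `1/8`. -/
lemma EqStar.sub_last_le (h : EqStar F φ) (hφ : ContDiff ℝ 2 φ) (hper : PeriodicPi φ)
    (p : Fin 5 → ℝ) (t : ℝ) : φ (p + t • Pi.single 4 1) - φ p ≤ 1 / 8 :=
  osc_le_of_neg_one_lt_pd2 hφ hper 4
    (fun x => by linarith [(h.factors_pos hφ hper x).2]) p t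

lemma exp_le_exp_CNorm (hF : ContDiff ℝ 2 F) (hFper : PeriodicPi F) (p : Fin 5 → ℝ) :
    Real.exp (F p) ≤ Real.exp (CNorm 2 F) :=
  Real.exp_le_exp.2 ((le_abs_self _).trans (abs_le_CNorm hF.continuous hFper p))

/-- A priori lower bound for the linearised operator on pure second derivatives. -/
lemma EqStar.neg_le_starLin_pd2 (h : EqStar F φ) (hF : ContDiff ℝ 2 F) (hFper : PeriodicPi F)
    (hφ : ContDiff ℝ 4 φ) (hper : PeriodicPi φ) (k : Fin 5) (p : Fin 5 → ℝ) :
    -(CNorm 2 F * Real.exp (CNorm 2 F)) ≤ starLin φ (pd2 k k φ) p := by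
  have h1 := h.le_starLin_pd2 hF hφ hper k p
  have h2 := abs_pd2_self_le_CNorm hF hFper k p
  have h3 := exp_le_exp_CNorm hF hFper p
  have h4 := mul_le_mul_of_nonneg_left (neg_le_of_abs_le h2) (Real.exp_pos (F p)).le
  have h5 := mul_le_mul_of_nonneg_left h3 ((abs_nonneg _).trans h2)
  linarith

/-- A priori bound for the Laplacian in the first four variables. -/
lemma EqStar.horizontal_laplacian_le (h : EqStar F φ) (hF : ContDiff ℝ 2 F)
    (hFper : PeriodicPi F) (hφ : ContDiff ℝ 4 φ) (hper : PeriodicPi φ) (x : Fin 5 → ℝ) :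
    pd2 0 0 φ x + pd2 1 1 φ x + pd2 2 2 φ x + pd2 3 3 φ x + 1
      ≤ (4 * CNorm 2 F + 2) * Real.exp (CNorm 2 F) + 1 / 4 := by
  have hφ2 : ContDiff ℝ 2 φ := hφ.of_le (by norm_num)
  have hc : ∀ i, ContDiff ℝ 2 (pd2 i i φ) := fun i => ContDiff.pd2 (m := 2) hφ i i
  have hψ : ContDiff ℝ 2 fun x => φ (dropLast x) := hφ2.comp dropLast.contDiff
  have hosc : ∀ y, φ y - φ (dropLast y) ≤ 1 / 8 ∧ -(1 / 8) ≤ φ y - φ (dropLast y) := by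
    intro y
    constructor
    · have h1 := h.sub_last_le hφ2 hper (dropLast y) (y 4)
      have h2 : dropLast y + y 4 • Pi.single 4 1 = y := by
        rw [dropLast_eq_add, neg_smul, neg_add_cancel_right]
      rwa [h2] at h1
    · have h1 := h.sub_last_le hφ2 hper y (-y 4)
      rw [← dropLast_eq_add] at h1
      linarith
  set H : (Fin 5 → ℝ) → ℝ := fun x => pd2 0 0 φ x + pd2 1 1 φ x + pd2 2 2 φ x + pd2 3 3 φ x
    with hH
  have hHc : ContDiff ℝ 2 H := by fun_prop
  have hHper : PeriodicPi H := fun y i => by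
    simp only [hH, hper.pd2 0 0 y i, hper.pd2 1 1 y i, hper.pd2 2 2 y i, hper.pd2 3 3 y i]
  obtain ⟨p, hp⟩ := PeriodicPi.exists_max (f := fun x => H x - (φ x - φ (dropLast x)))
    (fun y i => by simp only [hHper y i, hper y i, hper.comp_dropLast y i])
    (hHc.continuous.sub (hφ.continuous.sub hψ.continuous))
  have hL := h.starLin_nonpos_of_max hφ2 hper (hHc.sub (hφ2.sub hψ)) hp
  have hLψ : starLin φ (fun x => φ (dropLast x)) p = (pd2 4 4 φ p + 1) * H (dropLast p) := by
    simp only [starLin, pd2_last_comp_dropLast hφ2,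
      pd2_comp_dropLast hφ2 (show (0 : Fin 5) ≠ 4 by decide),
      pd2_comp_dropLast hφ2 (show (1 : Fin 5) ≠ 4 by decide),
      pd2_comp_dropLast hφ2 (show (2 : Fin 5) ≠ 4 by decide),
      pd2_comp_dropLast hφ2 (show (3 : Fin 5) ≠ 4 by decide), hH]
    ring
  have hLH : starLin φ H p = starLin φ (pd2 0 0 φ) p + starLin φ (pd2 1 1 φ) p
      + starLin φ (pd2 2 2 φ) p + starLin φ (pd2 3 3 φ) p := by
    rw [hH, starLin_add (((hc 0).add (hc 1)).add (hc 2)) (hc 3),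
      starLin_add ((hc 0).add (hc 1)) (hc 2), starLin_add (hc 0) (hc 1)]
  rw [starLin_sub hHc (hφ2.sub hψ), starLin_sub hφ2 hψ, starLin_self h, hLψ, hLH] at hL
  have hk := h.neg_le_starLin_pd2 hF hFper hφ hper
  have hE := exp_le_exp_CNorm hF hFper p
  have hB := (h.factors_pos hφ2 hper p).2
  have hA := (h.factors_pos hφ2 hper (dropLast p)).1
  have hBA := mul_pos hB hA
  have hx := hp x
  simp only [hH] at hx hL
  linarith [hk 0 p, hk 1 p, hk 2 p, hk 3 p, (hosc p).2, (hosc x).1]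

/-- A priori bound for the oscillation of a solution. -/
lemma EqStar.osc_le (h : EqStar F φ) (hF : ContDiff ℝ 2 F)
    (hFper : PeriodicPi F) (hφ : ContDiff ℝ 4 φ) (hper : PeriodicPi φ) (x y : Fin 5 → ℝ) :
    φ y - φ x ≤ ((4 * CNorm 2 F + 2) * Real.exp (CNorm 2 F) + 1 / 4) / 8 + 1 / 8 := by
  have hφ2 : ContDiff ℝ 2 φ := hφ.of_le (by norm_num)
  set C := (4 * CNorm 2 F + 2) * Real.exp (CNorm 2 F) + 1 / 4 with hC
  have hsum : ∀ z, ∑ j ∈ ({0, 1, 2, 3} : Finset (Fin 5)), pd2 j j φ z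
      = pd2 0 0 φ z + pd2 1 1 φ z + pd2 2 2 φ z + pd2 3 3 φ z := fun z => by
    simp; ring
  have hcoord : ∀ i ∈ ({0, 1, 2, 3} : Finset (Fin 5)), ∀ (p : Fin 5 → ℝ) (t : ℝ),
      φ (p + t • Pi.single i 1) - φ p ≤ C / 32 := by
    intro i hi p t
    have := osc_le_of_sum_pd2_bounds hφ2 hper {0, 1, 2, 3} (a := -1) (b := C - 1)
      (fun z => by rw [hsum]; linarith [(h.factors_pos hφ2 hper z).1])
      (fun z => by rw [hsum]; linarith [h.horizontal_laplacian_le hF hFper hφ hper z]) hi p t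
    linarith
  have hy : y = x + (y 0 - x 0) • Pi.single 0 1 + (y 1 - x 1) • Pi.single 1 1
      + (y 2 - x 2) • Pi.single 2 1 + (y 3 - x 3) • Pi.single 3 1
      + (y 4 - x 4) • Pi.single 4 1 := by
    ext i
    fin_cases i <;> simp
  have h0 := hcoord 0 (by simp) x (y 0 - x 0)
  have h1 := hcoord 1 (by simp) (x + (y 0 - x 0) • Pi.single 0 1) (y 1 - x 1)
  have h2 := hcoord 2 (by simp) (x + (y 0 - x 0) • Pi.single 0 1
    + (y 1 - x 1) • Pi.single 1 1) (y 2 - x 2)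
  have h3 := hcoord 3 (by simp) (x + (y 0 - x 0) • Pi.single 0 1
    + (y 1 - x 1) • Pi.single 1 1 + (y 2 - x 2) • Pi.single 2 1) (y 3 - x 3)
  have h4 := h.sub_last_le hφ2 hper (x + (y 0 - x 0) • Pi.single 0 1
    + (y 1 - x 1) • Pi.single 1 1 + (y 2 - x 2) • Pi.single 2 1
    + (y 3 - x 3) • Pi.single 3 1) (y 4 - x 4)
  rw [← hy] at h4
  linarith

/-- A priori upper bound for the Laplacian of a solution. -/
lemma EqStar.lap_le (h : EqStar F φ) (hF : ContDiff ℝ 2 F)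
    (hFper : PeriodicPi F) (hφ : ContDiff ℝ 4 φ) (hper : PeriodicPi φ) (x : Fin 5 → ℝ) :
    lap φ x ≤ (5 * CNorm 2 F + 2) * Real.exp (CNorm 2 F)
      + ((4 * CNorm 2 F + 2) * Real.exp (CNorm 2 F) + 1 / 4) / 8 + 1 / 8 := by
  have hφ2 : ContDiff ℝ 2 φ := hφ.of_le (by norm_num)
  have hc : ∀ i, ContDiff ℝ 2 (pd2 i i φ) := fun i => ContDiff.pd2 (m := 2) hφ i i
  have hlap : lap φ = fun x =>
      pd2 0 0 φ x + pd2 1 1 φ x + pd2 2 2 φ x + pd2 3 3 φ x + pd2 4 4 φ x := by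
    funext y
    rw [lap, Fin.sum_univ_five]
  have hlapc : ContDiff ℝ 2 (lap φ) := by rw [hlap]; fun_prop
  have hlapper : PeriodicPi (lap φ) := fun y i => by
    simp only [lap, hper.pd2 _ _ y i]
  obtain ⟨p, hp⟩ := PeriodicPi.exists_max (f := fun x => lap φ x - φ x)
    (fun y i => by simp only [hlapper y i, hper y i]) (hlapc.continuous.sub hφ.continuous)
  have hL := h.starLin_nonpos_of_max hφ2 hper (hlapc.sub hφ2) hp
  have hLlap : starLin φ (lap φ) p = starLin φ (pd2 0 0 φ) p + starLin φ (pd2 1 1 φ) p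
      + starLin φ (pd2 2 2 φ) p + starLin φ (pd2 3 3 φ) p + starLin φ (pd2 4 4 φ) p := by
    rw [hlap, starLin_add ((((hc 0).add (hc 1)).add (hc 2)).add (hc 3)) (hc 4),
      starLin_add (((hc 0).add (hc 1)).add (hc 2)) (hc 3),
      starLin_add ((hc 0).add (hc 1)) (hc 2), starLin_add (hc 0) (hc 1)]
  rw [starLin_sub hlapc hφ2, starLin_self h, hLlap] at hL
  have hk := h.neg_le_starLin_pd2 hF hFper hφ hper
  have hE := exp_le_exp_CNorm hF hFper p
  have hosc := h.osc_le hF hFper hφ hper p x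
  have hx := hp x
  have hlp : lap φ p = _ := congrFun hlap p
  linarith [hk 0 p, hk 1 p, hk 2 p, hk 3 p, hk 4 p]

lemma EqStar.neg_two_le_lap (h : EqStar F φ) (hφ : ContDiff ℝ 2 φ) (hper : PeriodicPi φ)
    (x : Fin 5 → ℝ) : -2 ≤ lap φ x := by
  have := h.factors_pos hφ hper x
  rw [lap, Fin.sum_univ_five]
  linarith

end Estimates

/-- A priori `C⁰`-estimate for the Laplacian of solutions of the quaternionic
Monge–Ampère equation on `T⁵`. -/
theorem laplacian_estimate :
    ∃ C₃ : ℝ → ℝ,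
      ∀ F φ : (Fin 5 → ℝ) → ℝ,
        ContDiff ℝ 2 F → PeriodicPi F →
        (∫ x in Set.Icc (0 : Fin 5 → ℝ) 1, (Real.exp (F x) - 1) = 0) →
        ContDiff ℝ 4 φ → PeriodicPi φ →
        (∫ x in Set.Icc ((fun _ => -(1/2)) : Fin 5 → ℝ) (fun _ => 1/2), φ x) = 0 →
        EqStar F φ →
        CNorm 0 (lap φ) ≤ C₃ (CNorm 2 F) := by
  refine ⟨fun c => 2 + (5 * c + 2) * Real.exp c
    + ((4 * c + 2) * Real.exp c + 1 / 4) / 8 + 1 / 8, ?_⟩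
  intro F φ hF hFper _ hφ hper _ h
  have hφ2 : ContDiff ℝ 2 φ := hφ.of_le (by norm_num)
  have hc : 0 ≤ CNorm 2 F := (abs_nonneg _).trans (abs_le_CNorm hF.continuous hFper 0)
  have hE := Real.exp_pos (CNorm 2 F)
  have h1 : 0 ≤ (5 * CNorm 2 F + 2) * Real.exp (CNorm 2 F) := by positivity
  have h2 : 0 ≤ (4 * CNorm 2 F + 2) * Real.exp (CNorm 2 F) := by positivity
  refine CNorm_zero_le (by positivity) fun x => abs_le.2 ⟨?_, ?_⟩
  · linarith [h.neg_two_le_lap hφ2 hper x]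
  · linarith [h.lap_le hF hFper hφ hper x]
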